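/- arXiv:2007.05016 — 2 statements merged into one kernel-verified Lean document; each statement's English description precedes it below -/
import Mathlib

section
/- Let k be an algebraically closed field, let n ≥ 0 be an integer, let B = k[x_1,…,x_n] be a polynomial ring, and let g ∈ B[s] be a polynomial in one further variable s such that for every t ∈ k the evaluation g(t) ∈ B (substituting s = t) is nonzero. Then the k-algebra homomorphism k[s,w] → B[s][w,w⁻¹] determined by s ↦ s and w ↦ g·w makes the Laurent polynomial ring B[s][w,w⁻¹] into a flat module over the polynomial ring k[s,w]. -/
open MvPolynomial in
/-- Over a Noetherian ring, a polynomial whose coefficients do not all lie in a common prime ideal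
is a nonzerodivisor modulo every extended ideal. -/
theorem MvPolynomial.mem_map_C_of_mul_mem {A σ : Type*} [CommRing A] [IsNoetherianRing A]
    {f : MvPolynomial σ A} (hf : ∀ p : Ideal A, p.IsPrime → f ∉ p.map C)
    (I : Ideal A) (s : MvPolynomial σ A) (hs : f * s ∈ I.map C) :
    s ∈ I.map C := by
  induction I using IsWellFounded.induction (α := Ideal A) (· > ·) generalizing s with
  | _ I ih =>
    by_cases hI : I = ⊤
    · simp [hI, Ideal.map_top]
    by_cases hp : I.IsPrime
    · have hq : (I.map (C : A →+* MvPolynomial σ A)).IsPrime := by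
        rw [← Ideal.mk_ker (I := I), ← MvPolynomial.ker_map]
        exact RingHom.ker_isPrime _
      exact (hq.mem_or_mem hs).resolve_left (hf I hp)
    · obtain ⟨a, ha, b, hb, hab⟩ :=
        (Ideal.not_isPrime_iff.mp hp).resolve_left hI
      have hlt : I < I ⊔ Ideal.span {a} :=
        left_lt_sup.mpr fun h ↦ ha (h (Ideal.mem_span_singleton_self a))
      have hle : I ≤ I.colon {a} := fun x hx ↦ by
        simpa [Submodule.mem_colon_singleton] using I.mul_mem_right a hx
      have hlt' : I < I.colon {a} := lt_of_le_of_ne hle fun h ↦ hb <| by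
        rw [h, Submodule.mem_colon_singleton, smul_eq_mul, mul_comm]
        exact hab
      have h₁ := ih _ hlt s (Ideal.map_mono hlt.le hs)
      rw [Ideal.map_sup, Ideal.map_span, Set.image_singleton, Submodule.mem_sup] at h₁
      obtain ⟨i, hi, y, hy, rfl⟩ := h₁
      obtain ⟨t, rfl⟩ := Ideal.mem_span_singleton.mp hy
      refine add_mem hi ?_
      have h₂ : C a * (f * t) ∈ I.map C := by
        have h := sub_mem hs (Ideal.mul_mem_left _ f hi)
        convert h using 1
        ring
      have h₃ : t ∈ (I.colon {a}).map C := by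
        refine ih _ hlt' t (mem_map_C_iff.mpr fun m ↦ ?_)
        have h := mem_map_C_iff.mp h₂ m
        rw [coeff_C_mul] at h
        rwa [Submodule.mem_colon_singleton, smul_eq_mul, mul_comm]
      refine mem_map_C_iff.mpr fun m ↦ ?_
      have h := mem_map_C_iff.mp h₃ m
      rw [Submodule.mem_colon_singleton, smul_eq_mul, mul_comm] at h
      rwa [coeff_C_mul]

open MvPolynomial in
/-- A hypersurface algebra `A[σ]/(f)` over a Noetherian ring `A` is flat over `A` if the
coefficients of `f` do not all lie in a common prime ideal. -/
theorem Module.Flat.of_surjective_of_ker_le_span_singleton {A M σ : Type*} [CommRing A]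
    [IsNoetherianRing A] [CommRing M] [Algebra A M] (π : MvPolynomial σ A →ₐ[A] M)
    (hπ : Function.Surjective π) {f : MvPolynomial σ A} (hfπ : π f = 0)
    (hker : ∀ q, π q = 0 → q ∈ Ideal.span {f})
    (hf : ∀ p : Ideal A, p.IsPrime → f ∉ p.map C) :
    Module.Flat A M := by
  refine Module.Flat.of_forall_isTrivialRelation fun {l a x} hx ↦ ?_
  choose s hs using fun i ↦ hπ (x i)
  have h₀ : π (∑ i, a i • s i) = 0 := by simpa [hs] using hx
  obtain ⟨t, ht⟩ := Ideal.mem_span_singleton.mp (hker _ h₀)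
  have hmem : t ∈ (Ideal.span (Set.range a)).map C := by
    refine mem_map_C_of_mul_mem hf _ t ?_
    rw [← ht]
    refine sum_mem fun i _ ↦ ?_
    rw [smul_eq_C_mul]
    exact Ideal.mul_mem_right _ _ (Ideal.mem_map_of_mem _ (Ideal.subset_span ⟨i, rfl⟩))
  rw [Ideal.map_span, ← Set.range_comp, Ideal.mem_span_range_iff_exists_fun] at hmem
  obtain ⟨c, hc⟩ := hmem
  have hrel : ∑ i, a i • (s i - f * c i) = 0 := by
    simp only [smul_sub, Finset.sum_sub_distrib, ht, ← hc, Finset.mul_sum, sub_eq_zero]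
    refine Finset.sum_congr rfl fun i _ ↦ ?_
    rw [smul_eq_C_mul, Function.comp_apply]
    ring
  obtain ⟨κ, b, y, hy, hb⟩ := Module.Flat.isTrivialRelation_of_sum_smul_eq_zero hrel
  refine ⟨κ, b, π ∘ y, fun i ↦ ?_, hb⟩
  simpa [hs, hfπ] using congrArg π (hy i)

/-- Pushing coefficients forward along `ψ : k[s] → E` commutes with rewriting a polynomial in `s`
over `k[x]` as a polynomial in `x` over `k[s]`. -/
theorem MvPolynomial.map_eval₂_map_C {k E σ : Type*} [CommSemiring k] [CommSemiring E]
    (ψ : Polynomial k →+* E) (g : Polynomial (MvPolynomial σ k)) :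
    MvPolynomial.map ψ (g.eval₂ (MvPolynomial.map Polynomial.C) (MvPolynomial.C Polynomial.X)) =
      g.eval₂ (MvPolynomial.map (ψ.comp Polynomial.C)) (MvPolynomial.C (ψ Polynomial.X)) := by
  rw [Polynomial.hom_eval₂, MvPolynomial.map_C]
  congr 1
  ext <;> simp

/-- A polynomial `g ∈ k[x][s]` with no zero fibre over the `s`-line remains nonzero after pushing
its coefficients forward along any ring homomorphism from `k[s]` to a nontrivial ring. -/
theorem Polynomial.eval₂_map_C_ne_zero {k D σ : Type*} [Field k] [IsAlgClosed k] [CommRing D]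
    [Nontrivial D] (φ : Polynomial k →+* D) {g : Polynomial (MvPolynomial σ k)}
    (hg : ∀ t : k, g.eval (MvPolynomial.C t) ≠ 0) :
    g.eval₂ (MvPolynomial.map (φ.comp Polynomial.C)) (MvPolynomial.C (φ Polynomial.X)) ≠ 0 := by
  intro h
  let g' : MvPolynomial σ (Polynomial k) :=
    g.eval₂ (MvPolynomial.map Polynomial.C) (MvPolynomial.C Polynomial.X)
  have hφ : g' ∈ (RingHom.ker φ).map MvPolynomial.C := by
    rw [← MvPolynomial.ker_map, RingHom.mem_ker, MvPolynomial.map_eval₂_map_C, h]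
  obtain ⟨d, hd⟩ := (IsPrincipalIdealRing.principal (RingHom.ker φ)).principal
  have hdeg : d.degree ≠ 0 := fun h0 ↦ RingHom.ker_ne_top φ <| by
    rw [hd, Ideal.submodule_span_eq, Ideal.span_singleton_eq_top]
    exact Polynomial.isUnit_iff_degree_eq_zero.mpr h0
  obtain ⟨t, ht⟩ := IsAlgClosed.exists_root d hdeg
  have hle : RingHom.ker φ ≤ RingHom.ker (Polynomial.evalRingHom t) := by
    rw [hd, Ideal.submodule_span_eq, Ideal.span_singleton_le_iff_mem]
    simpa using ht
  have hzero := Ideal.map_mono (f := (MvPolynomial.C : _ →+* MvPolynomial σ _)) hle hφ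
  rw [← MvPolynomial.ker_map, RingHom.mem_ker] at hzero
  refine hg t ?_
  have hid : (Polynomial.evalRingHom t).comp Polynomial.C = RingHom.id k := by ext; simp
  have hmap : MvPolynomial.map (σ := σ) (RingHom.id k) = RingHom.id _ := by ext <;> simp
  rwa [MvPolynomial.map_eval₂_map_C, hid, hmap, Polynomial.coe_evalRingHom,
    Polynomial.eval_X] at hzero

open MvPolynomial in
/-- The substitution `s ↦ s`, `w ↦ g·u` makes `k[x][s][u]` a flat `k[s,w]`-module if no fibre of
`g` over the `s`-line vanishes. -/
theorem flat_polynomial_of_eval_ne_zero {k σ : Type*} [Field k] [IsAlgClosed k]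
    (g : Polynomial (MvPolynomial σ k)) (hg : ∀ t : k, g.eval (C t) ≠ 0)
    [Algebra (MvPolynomial (Fin 2) k) (Polynomial (Polynomial (MvPolynomial σ k)))]
    (hC : ∀ c : k, algebraMap (MvPolynomial (Fin 2) k)
      (Polynomial (Polynomial (MvPolynomial σ k))) (C c) = Polynomial.C (Polynomial.C (C c)))
    (h0 : algebraMap (MvPolynomial (Fin 2) k)
      (Polynomial (Polynomial (MvPolynomial σ k))) (X 0) = Polynomial.C Polynomial.X)
    (h1 : algebraMap (MvPolynomial (Fin 2) k)
      (Polynomial (Polynomial (MvPolynomial σ k))) (X 1) = Polynomial.C g * Polynomial.X) :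
    Module.Flat (MvPolynomial (Fin 2) k) (Polynomial (Polynomial (MvPolynomial σ k))) := by
  let π : MvPolynomial (Option σ) (MvPolynomial (Fin 2) k) →ₐ[MvPolynomial (Fin 2) k]
      Polynomial (Polynomial (MvPolynomial σ k)) :=
    aeval fun o : Option σ ↦ o.elim Polynomial.X fun i ↦ Polynomial.C (Polynomial.C (X i))
  let τ : MvPolynomial σ k →+* MvPolynomial (Option σ) (MvPolynomial (Fin 2) k) :=
    eval₂Hom (C.comp C) fun i ↦ X (some i)
  let ρ : Polynomial (MvPolynomial σ k) →+* MvPolynomial (Option σ) (MvPolynomial (Fin 2) k) :=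
    Polynomial.eval₂RingHom τ (C (X 0))
  let θ : Polynomial (Polynomial (MvPolynomial σ k)) →+*
      MvPolynomial (Option σ) (MvPolynomial (Fin 2) k) :=
    Polynomial.eval₂RingHom ρ (X none)
  have hπC : ∀ a, π (C a) = algebraMap (MvPolynomial (Fin 2) k) _ a := fun a ↦ aeval_C _ a
  have hπn : π (X none) = Polynomial.X := by simp [π]
  have hπs : ∀ i, π (X (some i)) = Polynomial.C (Polynomial.C (X i)) := fun i ↦ by simp [π]
  have hτC : ∀ c, τ (C c) = C (C c) := fun c ↦ by simp [τ]
  have hτX : ∀ i, τ (X i) = X (some i) := fun i ↦ by simp [τ]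
  have hρC : ∀ b, ρ (Polynomial.C b) = τ b := fun b ↦ by simp [ρ]
  have hρX : ρ Polynomial.X = C (X 0) := by simp [ρ]
  have hθC : ∀ b, θ (Polynomial.C b) = ρ b := fun b ↦ by simp [θ]
  have hθX : θ Polynomial.X = X none := by simp [θ]
  have hπθ : (π : MvPolynomial (Option σ) (MvPolynomial (Fin 2) k) →+* _).comp θ =
      RingHom.id _ := by
    refine Polynomial.ringHom_ext' (Polynomial.ringHom_ext' (MvPolynomial.ringHom_ext ?_ ?_) ?_) ?_
    · intro c; simp [hθC, hρC, hτC, hπC, hC]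
    · intro i; simp [hθC, hρC, hτX, hπs]
    · simp [hθC, hρX, hπC, h0]
    · simp [hθX, hπn]
  have hπθ' : ∀ q, π (θ q) = q := fun q ↦ DFunLike.congr_fun hπθ q
  let f : MvPolynomial (Option σ) (MvPolynomial (Fin 2) k) := C (X 1) - ρ g * X none
  have hθf : θ (Polynomial.C g * Polynomial.X) = ρ g * X none := by rw [map_mul, hθC, hθX]
  refine Module.Flat.of_surjective_of_ker_le_span_singleton π (fun q ↦ ⟨θ q, hπθ' q⟩)
    (f := f) ?_ ?_ ?_
  · rw [map_sub, ← hθf, hπθ', hπC, h1, sub_self]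
  · have hmk : ((Ideal.Quotient.mk (Ideal.span {f})).comp θ).comp
        (π : MvPolynomial (Option σ) (MvPolynomial (Fin 2) k) →+* _) =
          Ideal.Quotient.mk (Ideal.span {f}) := by
      refine MvPolynomial.ringHom_ext' (MvPolynomial.ringHom_ext ?_ ?_) ?_
      · intro c; simp [hπC, hC, hθC, hρC, hτC]
      · intro i
        fin_cases i
        · simp [hπC, h0, hθC, hρX]
        · simp only [Fin.mk_one, RingHom.comp_apply, RingHom.coe_coe, hπC, h1, hθf]
          exact (Ideal.Quotient.eq.mpr (Ideal.mem_span_singleton_self f)).symm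
      · rintro (_ | i)
        · simp [hπn, hθX]
        · simp [hπs, hθC, hρC, hτX]
    intro q hq
    rw [← Ideal.Quotient.eq_zero_iff_mem, ← hmk]
    simp [hq]
  · intro p hp hfp
    rw [← Ideal.mk_ker (I := p), ← MvPolynomial.ker_map, RingHom.mem_ker] at hfp
    let mk := Ideal.Quotient.mk p
    let φ : Polynomial k →+* MvPolynomial (Fin 2) k ⧸ p := mk.comp (Polynomial.eval₂RingHom C (X 0))
    let ε : MvPolynomial σ (MvPolynomial (Fin 2) k ⧸ p) →
        MvPolynomial (Option σ) (MvPolynomial (Fin 2) k ⧸ p) →+*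
          MvPolynomial σ (MvPolynomial (Fin 2) k ⧸ p) :=
      fun z ↦ eval₂Hom C fun o : Option σ ↦ o.elim z X
    have hερ : ∀ z, ε z (MvPolynomial.map mk (ρ g)) =
        g.eval₂ (MvPolynomial.map (φ.comp Polynomial.C)) (C (φ Polynomial.X)) := by
      intro z
      have : ((ε z).comp (MvPolynomial.map mk)).comp ρ =
          Polynomial.eval₂RingHom (MvPolynomial.map (φ.comp Polynomial.C))
            (C (φ Polynomial.X)) := by
        refine Polynomial.ringHom_ext' (MvPolynomial.ringHom_ext ?_ ?_) ?_
        · intro c; simp [hρC, hτC, ε, φ]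
        · intro i; simp [hρC, hτX, ε]
        · simp [hρX, ε, φ]
      exact DFunLike.congr_fun this g
    have hε : ∀ z, C (mk (X 1)) - g.eval₂ (MvPolynomial.map (φ.comp Polynomial.C))
        (C (φ Polynomial.X)) * z = 0 := by
      intro z
      have h := congrArg (ε z) hfp
      rw [map_sub, map_mul, map_sub, map_mul, map_C, map_X, map_zero, hερ] at h
      simpa [ε] using h
    have hW := hε 0
    have hg1 := hε 1
    rw [mul_zero, sub_zero] at hW
    rw [hW, mul_one, zero_sub, neg_eq_zero] at hg1
    exact Polynomial.eval₂_map_C_ne_zero φ hg hg1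


/-- A localization of a flat algebra is flat over the base. -/
theorem Module.Flat.of_isLocalization_of_algebraMap_eq {A P L : Type*} [CommRing A] [CommRing P]
    [CommRing L] [Algebra A P] [Algebra A L] [Algebra P L] (S : Submonoid P) [IsLocalization S L]
    [Module.Flat A P] (h : algebraMap A L = (algebraMap P L).comp (algebraMap A P)) :
    Module.Flat A L :=
  have := IsScalarTower.of_algebraMap_eq' h
  have := IsLocalization.flat L S
  Module.Flat.trans A P L

/-- Let `k` be an algebraically closed field, `B = k[x_1,…,x_n]`,
and `g ∈ B[s]` with `g(t) ≠ 0` in `B` for every `t ∈ k`.  Then the `k`-algebra map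
`k[s,w] → B[s][w,w⁻¹]`, `s ↦ s`, `w ↦ g·w`, makes the Laurent polynomial ring
`B[s][w,w⁻¹]` a flat module over `k[s,w]`. -/
theorem stmt_0 (k : Type) [Field k] [IsAlgClosed k] (n : ℕ)
    (g : Polynomial (MvPolynomial (Fin n) k))
    (hg : ∀ t : k,
      Polynomial.eval (algebraMap k (MvPolynomial (Fin n) k) t) g ≠ 0) :
    letI : Algebra (MvPolynomial (Fin 2) k)
        (LaurentPolynomial (Polynomial (MvPolynomial (Fin n) k))) :=
      RingHom.toAlgebra
        (MvPolynomial.aeval (R := k)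
          (S₁ := LaurentPolynomial (Polynomial (MvPolynomial (Fin n) k)))
          ![LaurentPolynomial.C Polynomial.X,
            LaurentPolynomial.C g * LaurentPolynomial.T 1]).toRingHom
    Module.Flat (MvPolynomial (Fin 2) k)
      (LaurentPolynomial (Polynomial (MvPolynomial (Fin n) k))) := by
  let alg : Algebra (MvPolynomial (Fin 2) k)
      (LaurentPolynomial (Polynomial (MvPolynomial (Fin n) k))) :=
    RingHom.toAlgebra
      (MvPolynomial.aeval (R := k)
        (S₁ := LaurentPolynomial (Polynomial (MvPolynomial (Fin n) k)))
        ![LaurentPolynomial.C Polynomial.X,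
          LaurentPolynomial.C g * LaurentPolynomial.T 1]).toRingHom
  let alg' : Algebra (MvPolynomial (Fin 2) k)
      (Polynomial (Polynomial (MvPolynomial (Fin n) k))) :=
    RingHom.toAlgebra
      (MvPolynomial.aeval (R := k)
        (S₁ := Polynomial (Polynomial (MvPolynomial (Fin n) k)))
        ![Polynomial.C Polynomial.X, Polynomial.C g * Polynomial.X]).toRingHom
  have hL : ∀ a, algebraMap (MvPolynomial (Fin 2) k)
      (LaurentPolynomial (Polynomial (MvPolynomial (Fin n) k))) a =
      MvPolynomial.aeval (R := k)
        (S₁ := LaurentPolynomial (Polynomial (MvPolynomial (Fin n) k)))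
        ![LaurentPolynomial.C Polynomial.X,
          LaurentPolynomial.C g * LaurentPolynomial.T 1] a := fun _ ↦ rfl
  have hP : ∀ a, algebraMap (MvPolynomial (Fin 2) k)
      (Polynomial (Polynomial (MvPolynomial (Fin n) k))) a =
      MvPolynomial.aeval (R := k)
        (S₁ := Polynomial (Polynomial (MvPolynomial (Fin n) k)))
        ![Polynomial.C Polynomial.X, Polynomial.C g * Polynomial.X] a := fun _ ↦ rfl
  have hPC : ∀ c, algebraMap (MvPolynomial (Fin 2) k)
      (Polynomial (Polynomial (MvPolynomial (Fin n) k))) (MvPolynomial.C c) =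
      Polynomial.C (Polynomial.C (MvPolynomial.C c)) := fun c ↦ by
    rw [hP, MvPolynomial.aeval_C]
    rfl
  have hLC : ∀ c, algebraMap (MvPolynomial (Fin 2) k)
      (LaurentPolynomial (Polynomial (MvPolynomial (Fin n) k))) (MvPolynomial.C c) =
      LaurentPolynomial.C (Polynomial.C (MvPolynomial.C c)) := fun c ↦ by
    rw [hL, MvPolynomial.aeval_C]
    rfl
  have hflat : Module.Flat (MvPolynomial (Fin 2) k)
      (Polynomial (Polynomial (MvPolynomial (Fin n) k))) :=
    flat_polynomial_of_eval_ne_zero g hg hPC (by simp [hP]) (by simp [hP])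
  refine Module.Flat.of_isLocalization_of_algebraMap_eq (A := MvPolynomial (Fin 2) k)
    (P := Polynomial (Polynomial (MvPolynomial (Fin n) k)))
    (L := LaurentPolynomial (Polynomial (MvPolynomial (Fin n) k)))
    (Submonoid.powers Polynomial.X) ?_
  refine MvPolynomial.ringHom_ext (fun c ↦ ?_) fun i ↦ ?_
  · simp [hPC, hLC]
  · fin_cases i <;> simp [hP, hL]
end

section
/- For every integer d with 1 ≤ d ≤ 50, the following identity holds in ℚ: Σ over all integers r ≥ 1 and all ordered r-tuples (d_1, …, d_r) of positive integers with d_1 + ⋯ + d_r = d of (1/r!) · 2^{r−1} · d^{r−2} · ∏_{i=1}^r ((−1)^{d_i−1}/d_i) · C(3d_i, d_i) equals (1/d²) · C(4d−1, d). -/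
open Finset in
theorem ringChoose_eq_prod_div (a : ℚ) (n : ℕ) :
    Ring.choose a n = (∏ i ∈ range n, (a - i)) / n.factorial := by
  rw [Ring.choose_eq_smul, ← descPochhammer_eval_eq_prod_range,
    ← descPochhammer_map (Int.castRingHom ℚ), Polynomial.eval_map,
    ← Polynomial.eval₂_smulOneHom_eq_smeval, smul_eq_mul, inv_mul_eq_div]
  congr! 2
  exact Subsingleton.elim _ _

/-- The Rothe–Hagen coefficient `x / (x + k z) * (x + k z).choose k`, with the apparent pole at
`x + k z = 0` removed. -/
noncomputable def rotheCoeff (x z : ℚ) : ℕ → ℚ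
  | 0 => 1
  | k + 1 => x / (k + 1) * Ring.choose (x + (k + 1) * z - 1) k

open Finset in
theorem rotheCoeff_mul_choose (x z : ℚ) (n : ℕ) {k j : ℕ} (h : k + j = n + 1) :
    rotheCoeff x z k * Ring.choose (-x - k * z + n) j =
      (-1) ^ j * (n + 1).choose k *
        (x / (n + 1).factorial * ∏ i ∈ range n, (x + k * z - 1 - i)) := by
  have reflected : ∏ i ∈ range j, (-x - k * z + n - i) =
      (-1) ^ j * ∏ i ∈ range j, (x + k * z - k - i) := by
    have hsign : (-1 : ℚ) ^ j = ∏ _i ∈ range j, -1 := by simp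
    rw [← prod_range_reflect, hsign, ← prod_mul_distrib]
    refine prod_congr rfl fun i hi => ?_
    have hi' : i + 1 ≤ j := by simpa using hi
    have hn : (n : ℚ) = k + j - 1 := by
      rw [eq_sub_iff_add_eq]; exact_mod_cast h.symm
    rw [Nat.sub_sub, add_comm 1 i, Nat.cast_sub hi', hn]
    push_cast
    ring
  have choose_eq : ((n + 1).choose k : ℚ) =
      (n + 1).factorial / (k.factorial * j.factorial) := by
    rw [← h, Nat.cast_add_choose]
  have fact_ne : ((n + 1).factorial : ℚ) ≠ 0 := by positivity
  rw [ringChoose_eq_prod_div, reflected, choose_eq]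
  cases k with
  | zero =>
    obtain rfl : j = n + 1 := by omega
    rw [prod_range_succ', rotheCoeff]
    simp only [Nat.cast_zero, zero_mul, add_zero, sub_zero, Nat.factorial_zero, Nat.cast_one,
      one_mul, Nat.cast_add]
    rw [prod_congr rfl fun (i : ℕ) _ => show x - (i + 1 : ℚ) = x - 1 - i by ring]
    field_simp
  | succ k =>
    obtain rfl : n = k + j := by omega
    rw [rotheCoeff, ringChoose_eq_prod_div, prod_range_add, Nat.factorial_succ k]
    push_cast
    rw [prod_congr rfl fun (i : ℕ) _ =>
      show x + (k + 1 : ℚ) * z - (k + 1) - i = x + (k + 1) * z - 1 - (k + i) by ring]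
    field_simp

open Finset Polynomial in
theorem sum_rotheCoeff_mul_choose_eq_zero (x z : ℚ) (n : ℕ) :
    ∑ p ∈ antidiagonal (n + 1), rotheCoeff x z p.1 * Ring.choose (-x - p.1 * z + n) p.2 = 0 := by
  let P : ℚ[X] := C (x / (n + 1).factorial) * ∏ i ∈ range n, (C (x - 1 - i) + C z * X)
  have natDegree_lt : P.natDegree < n + 1 := by
    refine Nat.lt_succ_of_le ((natDegree_C_mul_le _ _).trans ((natDegree_prod_le _ _).trans ?_))
    refine (sum_le_card_nsmul _ _ 1 fun i _ => ?_).trans (by simp)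
    compute_degree
  have diff := congrFun (fwdDiff_iter_eq_zero_of_degree_lt natDegree_lt) 0
  rw [fwdDiff_iter_eq_sum_shift, Pi.zero_apply] at diff
  rw [Nat.sum_antidiagonal_eq_sum_range_succ_mk, ← diff]
  refine sum_congr rfl fun k hk => ?_
  have hk' : k ≤ n + 1 := by simpa [Nat.lt_succ_iff] using hk
  rw [rotheCoeff_mul_choose x z n (Nat.add_sub_of_le hk')]
  simp only [P, eval_mul, eval_C, eval_prod, eval_add, eval_X, zsmul_eq_mul, nsmul_eq_mul]
  push_cast
  congr 2
  exact prod_congr rfl fun i _ => by ring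

open Finset in
/-- The **Rothe–Hagen identity**, at an integer total `t`. -/
theorem sum_rotheCoeff_mul_choose (x z : ℚ) (n : ℕ) (t : ℤ) :
    ∑ p ∈ antidiagonal n, rotheCoeff x z p.1 * Ring.choose (-x - p.1 * z + t) p.2 =
      Ring.choose (t : ℚ) n := by
  induction n generalizing t with
  | zero => simp [rotheCoeff]
  | succ n ih =>
    have step (t : ℤ) :
        ∑ p ∈ antidiagonal (n + 1),
            rotheCoeff x z p.1 * Ring.choose (-x - p.1 * z + (t + 1 : ℤ)) p.2 =
          Ring.choose (t : ℚ) n + ∑ p ∈ antidiagonal (n + 1),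
            rotheCoeff x z p.1 * Ring.choose (-x - p.1 * z + t) p.2 := by
      rw [Nat.sum_antidiagonal_succ', Nat.sum_antidiagonal_succ', ← ih t]
      simp only [Int.cast_add, Int.cast_one, ← add_assoc, Ring.choose_succ_succ, mul_add,
        sum_add_distrib, Ring.choose_zero_right]
      ring
    induction t using Int.inductionOn' (b := n) with
    | zero =>
      rw [Int.cast_natCast, Ring.choose_natCast, Nat.choose_succ_self, Nat.cast_zero]
      exact sum_rotheCoeff_mul_choose_eq_zero x z n
    | succ t _ ht =>
      rw [step, ht, Int.cast_add, Int.cast_one, Ring.choose_succ_succ]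
    | pred t _ ht =>
      have := step (t - 1)
      rw [sub_add_cancel, ht, ← sub_add_cancel (t : ℚ) 1, Ring.choose_succ_succ] at this
      push_cast at this ⊢
      linarith

open Finset in
theorem rotheCoeff_recurrence (x z : ℤ) (n : ℕ) :
    x * ∑ p ∈ antidiagonal n,
        rotheCoeff x z p.1 * Ring.choose ((p.2 + 1) * z : ℚ) (p.2 + 1) =
      z * (n + 1) * rotheCoeff x z (n + 1) := by
  have total := sum_rotheCoeff_mul_choose x z (n + 1) (x + (n + 1) * z)
  have absorb : (n + 1 : ℚ) * Ring.choose (x + (n + 1) * z : ℚ) (n + 1) =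
      (x + (n + 1) * z) * Ring.choose (x + (n + 1) * z - 1 : ℚ) n := by
    rw [ringChoose_eq_prod_div, ringChoose_eq_prod_div, prod_range_succ', Nat.factorial_succ]
    push_cast
    rw [prod_congr rfl fun (i : ℕ) _ =>
      show (x + (n + 1) * z - (i + 1) : ℚ) = x + (n + 1) * z - 1 - i by ring]
    field_simp
    ring
  rw [Nat.sum_antidiagonal_succ', Ring.choose_zero_right, mul_one] at total
  have shift : ∑ p ∈ antidiagonal n, rotheCoeff x z p.1 *
        Ring.choose (-x - p.1 * z + (x + (n + 1) * z : ℤ) : ℚ) (p.2 + 1) =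
      ∑ p ∈ antidiagonal n,
        rotheCoeff x z p.1 * Ring.choose ((p.2 + 1) * z : ℚ) (p.2 + 1) := by
    refine sum_congr rfl fun p hp => ?_
    rw [← mem_antidiagonal.mp hp]
    congr 2
    push_cast
    ring
  rw [shift, rotheCoeff] at total
  rw [eq_sub_of_add_eq' total, rotheCoeff]
  push_cast
  field_simp at absorb ⊢
  linear_combination (x : ℚ) * absorb

open Finset PowerSeries in
/-- The partial sums of `exp (m f)` are determined, up to the truncation order, by the recurrence
coming from the differential equation `E' = m f' E`. -/
theorem coeff_expPartialSum (f : PowerSeries ℚ) (hf : constantCoeff f = 0) (m : ℚ) (e : ℕ → ℚ)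
    (e_zero : e 0 = 1)
    (e_succ : ∀ n, (n + 1) * e (n + 1) =
      m * ∑ p ∈ antidiagonal n, (coeff (p.1 + 1) f * (p.1 + 1)) * e p.2)
    {N n : ℕ} (hn : n < N) :
    coeff n (∑ r ∈ range N, C (m ^ r / r.factorial) * f ^ r) = e n := by
  have deriv (N : ℕ) : derivative ℚ (∑ r ∈ range (N + 1), C (m ^ r / r.factorial) * f ^ r) =
      C m * (derivative ℚ f * ∑ r ∈ range N, C (m ^ r / r.factorial) * f ^ r) := by
    induction N with
    | zero => simp
    | succ N ih =>
      rw [sum_range_succ, map_add, ih, sum_range_succ _ N, mul_add, mul_add]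
      congr 1
      have hC : C (m ^ (N + 1) / ((N + 1).factorial : ℚ)) * (N + 1 : ℚ⟦X⟧) =
          C m * C (m ^ N / (N.factorial : ℚ)) := by
        rw [← map_natCast (C (R := ℚ)), ← map_one (C (R := ℚ)), ← map_add, ← map_mul, ← map_mul,
          Nat.factorial_succ]
        congr 1
        push_cast
        field_simp
        ring
      rw [Derivation.leibniz, derivative_C, Derivation.leibniz_pow]
      simp only [smul_eq_mul, nsmul_eq_mul, mul_zero, add_zero, Nat.add_sub_cancel]
      push_cast
      linear_combination (f ^ N * derivative ℚ f) * hC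
  induction N generalizing n with
  | zero => omega
  | succ N ih =>
    cases n with
    | zero =>
      rw [e_zero, sum_range_succ', coeff_zero_eq_constantCoeff_apply]
      simp [hf]
    | succ n =>
      have hcoeff := congrArg (coeff n) (deriv N)
      rw [coeff_derivative, coeff_C_mul, coeff_mul] at hcoeff
      have hne : (n + 1 : ℚ) ≠ 0 := by positivity
      rw [← mul_left_inj' hne, hcoeff, mul_comm (e _), e_succ]
      congr 1
      refine sum_congr rfl fun p hp => ?_
      have := mem_antidiagonal.mp hp
      rw [ih (by omega), coeff_derivative]

open Finset PowerSeries in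
theorem coeff_pow_eq_sum_antidiagonalTuple {R : Type*} [CommSemiring R] (f : PowerSeries R)
    (r n : ℕ) :
    coeff n (f ^ r) = ∑ l ∈ Finset.Nat.antidiagonalTuple r n, ∏ i, coeff (l i) f := by
  rw [← Fin.prod_const, coeff_prod]
  refine sum_bij' (fun l _ => l) (fun l _ => Finsupp.equivFunOnFinite.symm l) ?_ ?_ ?_ ?_ ?_
  all_goals simp [Finset.Nat.mem_antidiagonalTuple, mem_finsuppAntidiag]

/-- The series `∑ (-1)^(k-1) / k * (3k).choose k * X^k`, i.e. `-3 log B₃(-X)` for the generalized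
binomial series `B₃`. -/
noncomputable def logBinomialSeries : PowerSeries ℚ :=
  PowerSeries.mk fun k => (-1 : ℚ) ^ (k - 1) / k * (Nat.choose (3 * k) k : ℚ)

open Finset PowerSeries in
theorem coeff_expPartialSum_logBinomialSeries (d : ℕ) {N n : ℕ} (hn : n < N) :
    coeff n (∑ r ∈ range N, C ((2 * d : ℚ) ^ r / r.factorial) * logBinomialSeries ^ r) =
      (-1) ^ n * rotheCoeff (-6 * d) 3 n := by
  refine coeff_expPartialSum _ ?_ _ (fun n => (-1) ^ n * rotheCoeff (-6 * d) 3 n) ?_ ?_ hn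
  · rw [← coeff_zero_eq_constantCoeff_apply]
    simp [logBinomialSeries]
  · simp [rotheCoeff]
  · intro n
    have recurrence := rotheCoeff_recurrence (-6 * d) 3 n
    push_cast at recurrence
    have signs : ∑ p ∈ antidiagonal n, coeff (p.1 + 1) logBinomialSeries * (p.1 + 1) *
          ((-1) ^ p.2 * rotheCoeff (-6 * d) 3 p.2) =
        (-1) ^ n * ∑ p ∈ antidiagonal n,
          rotheCoeff (-6 * d) 3 p.1 * Ring.choose ((p.2 + 1) * 3 : ℚ) (p.2 + 1) := by
      rw [mul_sum, ← Nat.sum_antidiagonal_swap]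
      refine sum_congr rfl fun p hp => ?_
      have hchoose : Ring.choose ((p.2 + 1) * 3 : ℚ) (p.2 + 1) =
          (Nat.choose (3 * (p.2 + 1)) (p.2 + 1) : ℚ) := by
        rw [← Ring.choose_natCast]
        push_cast
        rw [mul_comm]
      rw [hchoose, ← mem_antidiagonal.mp hp, logBinomialSeries]
      simp only [coeff_mk, Prod.fst_swap, Prod.snd_swap, Nat.add_sub_cancel]
      push_cast
      field_simp
      ring
    rw [signs]
    linear_combination (-1 : ℚ) ^ n / 3 * recurrence

theorem neg_one_pow_mul_rotheCoeff_self (d : ℕ) (hd : 1 ≤ d) :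
    (-1 : ℚ) ^ d * rotheCoeff (-6 * d) 3 d = 2 * (Nat.choose (4 * d - 1) d : ℚ) := by
  obtain ⟨k, rfl⟩ := Nat.exists_eq_add_of_le' hd
  have hchoose : Ring.choose (-6 * (k + 1 : ℚ) + (k + 1) * 3 - 1) k =
      (-1) ^ k * (Nat.choose (4 * k + 3) k : ℚ) := by
    rw [show (-6 * (k + 1 : ℚ) + (k + 1) * 3 - 1) = -(3 * k + 4) by ring, Ring.choose_neg,
      show (3 * k + 4 + k - 1 : ℚ) = (4 * k + 3 : ℕ) by push_cast; ring, Ring.choose_natCast,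
      Int.negOnePow_def]
    simp [Units.smul_def]
  have habsorb := Nat.choose_succ_right_eq (4 * k + 3) k
  rw [show 4 * k + 3 - k = 3 * (k + 1) by omega] at habsorb
  have habsorb' : (Nat.choose (4 * k + 3) (k + 1) : ℚ) = 3 * Nat.choose (4 * k + 3) k := by
    have hne : (k + 1 : ℚ) ≠ 0 := by positivity
    rw [← mul_left_inj' hne]
    have : ((Nat.choose (4 * k + 3) (k + 1) * (k + 1) : ℕ) : ℚ) =
      (Nat.choose (4 * k + 3) k * (3 * (k + 1)) : ℕ) := congrArg _ habsorb
    push_cast at this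
    linear_combination this
  have hsq : ((-1 : ℚ) ^ k) * (-1) ^ k = 1 := by rw [← mul_pow]; simp
  rw [show 4 * (k + 1) - 1 = 4 * k + 3 by omega, habsorb', rotheCoeff]
  push_cast
  rw [hchoose]
  field_simp
  linear_combination (6 * (Nat.choose (4 * k + 3) k : ℚ)) * hsq


/-- (Combinatorial Conjecture 5.3 of the paper, verified for
`d ≤ 50`.)  For every `1 ≤ d ≤ 50`, the sum over all `r ≥ 1` (necessarily
`1 ≤ r ≤ d`) and all ordered `r`-tuples `(d_1, …, d_r)` of positive integers with
`d_1 + ⋯ + d_r = d` of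
`(1/r!) · 2^{r−1} · d^{r−2} · ∏_i ((−1)^{d_i−1}/d_i) · C(3d_i, d_i)`
equals `(1/d²) · C(4d−1, d)`, where `d^{r−2}` is computed in `ℚ` (so it equals
`1/d` when `r = 1`). -/
theorem stmt_8 (d : ℕ) (hd1 : 1 ≤ d) (hd2 : d ≤ 50) :
    ∑ r ∈ Finset.Icc 1 d,
        ∑ f ∈ (Finset.Nat.antidiagonalTuple r d).filter (fun f => ∀ i, 0 < f i),
          (1 / (r.factorial : ℚ)) * 2 ^ (r - 1) * (d : ℚ) ^ ((r : ℤ) - 2) *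
            ∏ i, (((-1 : ℚ) ^ (f i - 1) / (f i : ℚ)) * (Nat.choose (3 * f i) (f i) : ℚ))
      = (1 / (d : ℚ) ^ 2) * (Nat.choose (4 * d - 1) d : ℚ) := by
  have summand_eq (r : ℕ) (hr : r ∈ Finset.Icc 1 d) :
      ∑ f ∈ (Finset.Nat.antidiagonalTuple r d).filter (fun f => ∀ i, 0 < f i),
          (1 / (r.factorial : ℚ)) * 2 ^ (r - 1) * (d : ℚ) ^ ((r : ℤ) - 2) *
            ∏ i, (((-1 : ℚ) ^ (f i - 1) / (f i : ℚ)) * (Nat.choose (3 * f i) (f i) : ℚ)) =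
        1 / (2 * (d : ℚ) ^ 2) * PowerSeries.coeff d
          (PowerSeries.C ((2 * d : ℚ) ^ r / r.factorial) * logBinomialSeries ^ r) := by
    have hd : (d : ℚ) ≠ 0 := by positivity
    obtain ⟨s, rfl⟩ := Nat.exists_eq_add_of_le' (Finset.mem_Icc.mp hr).1
    rw [← Finset.mul_sum, PowerSeries.coeff_C_mul, coeff_pow_eq_sum_antidiagonalTuple,
      Finset.sum_filter_of_ne, zpow_sub₀ hd, zpow_natCast]
    · simp only [logBinomialSeries, PowerSeries.coeff_mk, Nat.add_sub_cancel]
      rw [← mul_assoc]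
      congr 1
      rw [mul_pow, pow_succ (2 : ℚ) s, zpow_ofNat]
      field_simp
    · intro f _ hf i
      contrapose! hf
      refine Finset.prod_eq_zero (Finset.mem_univ i) ?_
      simp [Nat.le_zero.mp hf]
  have main := coeff_expPartialSum_logBinomialSeries d (Nat.lt_succ_self d)
  rw [neg_one_pow_mul_rotheCoeff_self d hd1, map_sum, Finset.range_eq_Ico,
    Finset.sum_eq_sum_Ico_succ_bot (Nat.succ_pos d)] at main
  have coeff_zeroth : PowerSeries.coeff d
      (PowerSeries.C ((2 * d : ℚ) ^ 0 / (Nat.factorial 0)) * logBinomialSeries ^ 0) = 0 := by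
    simp [PowerSeries.coeff_one, Nat.one_le_iff_ne_zero.mp hd1]
  rw [coeff_zeroth, zero_add] at main
  rw [Finset.sum_congr rfl summand_eq, ← Finset.mul_sum,
    show Finset.Icc 1 d = Finset.Ico (0 + 1) d.succ by ext; simp, main]
  field_simp
end
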